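/- arXiv:1506.04286 — 2 statements merged into one kernel-verified Lean document; each statement's English description precedes it below -/
import Mathlib

section
/- Let G be an abelian group, π : G → G/2G the quotient map, and m ≥ 0 an integer. Let P₁, P₂ ∈ G be such that P₁ ∉ 2^{m+1}·G and P₁ − P₂ ∈ 2^{m+1}·G. Then ν(P₁) = ν(P₂) and q(P₁) = q(P₂). -/
/-- The subgroup `2·G` of an abelian group `G`. -/
def twoSub (G : Type*) [AddCommGroup G] : AddSubgroup G where
  carrier := {x | ∃ y : G, 2 • y = x}
  add_mem' := by rintro a b ⟨y, rfl⟩ ⟨z, rfl⟩; exact ⟨y + z, by rw [smul_add]⟩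
  zero_mem' := ⟨0, smul_zero 2⟩
  neg_mem' := by rintro a ⟨y, rfl⟩; exact ⟨-y, by rw [smul_neg]⟩

/-- `q(P) = {π(Q) : Q ∈ G, 2^n • Q = P for some n ≥ 0}` where `π : G → G/2G`. -/
def qmap {G : Type*} [AddCommGroup G] (P : G) : Set (G ⧸ twoSub G) :=
  {ξ | ∃ Q : G, (∃ n : ℕ, 2 ^ n • Q = P) ∧ QuotientAddGroup.mk' (twoSub G) Q = ξ}

/-- `ν(P) = sup {n : P ∈ 2ⁿ·G} ∈ ℕ∞`. -/
noncomputable def nuval {G : Type*} [AddCommGroup G] (P : G) : ℕ∞ :=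
  sSup {x : ℕ∞ | ∃ n : ℕ, x = (n : ℕ∞) ∧ ∃ Q : G, 2 ^ n • Q = P}

/-- An element divisible by `2 ^ k` is divisible by every smaller power of two. -/
theorem exists_two_pow_smul_of_le {G : Type*} [AddCommGroup G] {P : G} {k n : ℕ} (hkn : k ≤ n)
    (h : ∃ Q : G, 2 ^ n • Q = P) : ∃ Q : G, 2 ^ k • Q = P := by
  obtain ⟨Q, rfl⟩ := h
  exact ⟨2 ^ (n - k) • Q, by rw [smul_smul, ← pow_add, Nat.add_sub_cancel' hkn]⟩

/-- If `P₁ ∉ 2^{m+1}·G` and `P₁ ≡ P₂ mod 2^{m+1}·G`, every `2 ^ n`-division point of `P₁` is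
congruent modulo `2·G` to a `2 ^ n`-division point of `P₂`. -/
theorem exists_two_pow_smul_eq_and_mk_eq {G : Type*} [AddCommGroup G] {m n : ℕ} {P₁ P₂ Q : G}
    (h1 : ¬ ∃ Q : G, 2 ^ (m + 1) • Q = P₁) (h2 : ∃ Q : G, 2 ^ (m + 1) • Q = P₁ - P₂)
    (hQ : 2 ^ n • Q = P₁) :
    ∃ Q' : G, 2 ^ n • Q' = P₂ ∧
      QuotientAddGroup.mk' (twoSub G) Q' = QuotientAddGroup.mk' (twoSub G) Q := by
  obtain ⟨R, hR⟩ := h2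
  have hn : n ≤ m := by
    by_contra! h
    exact h1 (exists_two_pow_smul_of_le h ⟨Q, hQ⟩)
  obtain ⟨d, rfl⟩ := Nat.exists_eq_add_of_le hn
  refine ⟨Q - 2 ^ (d + 1) • R, ?_, ?_⟩
  · rw [smul_sub, smul_smul, ← pow_add, ← add_assoc, hR, hQ, sub_sub_cancel]
  · refine QuotientAddGroup.eq.mpr ⟨2 ^ d • R, ?_⟩
    rw [smul_smul, ← pow_succ']
    abel

/-- The hypotheses of `exists_two_pow_smul_eq_and_mk_eq` are symmetric in the two points. -/
theorem two_pow_congr_symm {G : Type*} [AddCommGroup G] {k : ℕ} {P₁ P₂ : G}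
    (h1 : ¬ ∃ Q : G, 2 ^ k • Q = P₁) (h2 : ∃ Q : G, 2 ^ k • Q = P₁ - P₂) :
    (¬ ∃ Q : G, 2 ^ k • Q = P₂) ∧ ∃ Q : G, 2 ^ k • Q = P₂ - P₁ := by
  obtain ⟨R, hR⟩ := h2
  refine ⟨?_, -R, by rw [smul_neg, hR, neg_sub]⟩
  rintro ⟨Q, hQ⟩
  exact h1 ⟨R + Q, by rw [smul_add, hR, hQ, sub_add_cancel]⟩

theorem nuval_le_of_congr {G : Type*} [AddCommGroup G] {m : ℕ} {P₁ P₂ : G}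
    (h1 : ¬ ∃ Q : G, 2 ^ (m + 1) • Q = P₁) (h2 : ∃ Q : G, 2 ^ (m + 1) • Q = P₁ - P₂) :
    nuval P₁ ≤ nuval P₂ := by
  refine sSup_le_sSup ?_
  rintro x ⟨n, hx, Q, hQ⟩
  obtain ⟨Q', hQ', -⟩ := exists_two_pow_smul_eq_and_mk_eq h1 h2 hQ
  exact ⟨n, hx, Q', hQ'⟩

theorem qmap_subset_of_congr {G : Type*} [AddCommGroup G] {m : ℕ} {P₁ P₂ : G}
    (h1 : ¬ ∃ Q : G, 2 ^ (m + 1) • Q = P₁) (h2 : ∃ Q : G, 2 ^ (m + 1) • Q = P₁ - P₂) :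
    qmap P₁ ⊆ qmap P₂ := by
  rintro ξ ⟨Q, ⟨n, hQ⟩, hξ⟩
  obtain ⟨Q', hQ', h⟩ := exists_two_pow_smul_eq_and_mk_eq h1 h2 hQ
  exact ⟨Q', ⟨n, hQ'⟩, h.trans hξ⟩

/-- Lemma 3.1: if `P₁ ∉ 2^{m+1}·G` and `P₁ ≡ P₂ mod 2^{m+1}·G`, then `ν(P₁) = ν(P₂)`
and `q(P₁) = q(P₂)`. -/
theorem stmt12 (G : Type*) [AddCommGroup G] (m : ℕ) (P₁ P₂ : G)
    (h1 : ¬ ∃ Q : G, 2 ^ (m + 1) • Q = P₁)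
    (h2 : ∃ Q : G, 2 ^ (m + 1) • Q = P₁ - P₂) :
    nuval P₁ = nuval P₂ ∧ qmap P₁ = qmap P₂ := by
  obtain ⟨h1', h2'⟩ := two_pow_congr_symm h1 h2
  exact ⟨(nuval_le_of_congr h1 h2).antisymm (nuval_le_of_congr h1' h2'),
    (qmap_subset_of_congr h1 h2).antisymm (qmap_subset_of_congr h1' h2')⟩
end

section
/- Let G be an abelian group, π : G → G/2G the quotient map, and n₀ ≥ 0 an integer such that every element of G of 2-power order is killed by 2^{n₀} (i.e., G[2^∞] ⊆ G[2^{n₀}]). Let P ∈ G with ν(P) > n₀ (i.e., P ∈ 2^{n₀+1}·G). Then ν(2P) = ν(P) + 1 and q(2P) = q(P). -/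
section

variable {G : Type*} [AddCommGroup G] {n₀ : ℕ}

theorem pow_two_smul_eq_of_pow_succ_smul_eq
    (htors : ∀ x : G, (∃ k : ℕ, 2 ^ k • x = 0) → 2 ^ n₀ • x = 0)
    {R Q : G} {j : ℕ} (h : 2 ^ (n₀ + j + 1) • Q = 2 • 2 ^ (n₀ + 1) • R) :
    2 ^ (n₀ + j) • Q = 2 ^ (n₀ + 1) • R := by
  have key : 2 ^ n₀ • (2 ^ j • Q - 2 • R) = 0 := by
    refine htors _ ⟨n₀ + 1, ?_⟩
    rw [smul_sub, sub_eq_zero, smul_smul, smul_smul]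
    rw [smul_smul] at h
    convert h using 2 <;> ring
  rw [smul_sub, sub_eq_zero, smul_smul, smul_smul] at key
  convert key using 2 <;> ring

theorem exists_pow_succ_smul_eq_two_smul_iff
    (htors : ∀ x : G, (∃ k : ℕ, 2 ^ k • x = 0) → 2 ^ n₀ • x = 0)
    {P : G} (hP : ∃ Q : G, 2 ^ (n₀ + 1) • Q = P) (m : ℕ) :
    (∃ Q : G, 2 ^ (m + 1) • Q = 2 • P) ↔ ∃ Q : G, 2 ^ m • Q = P := by
  constructor
  · obtain ⟨R, rfl⟩ := hP
    rintro ⟨Q, hQ⟩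
    obtain hm | hm := le_total n₀ m
    · obtain ⟨j, rfl⟩ := Nat.exists_eq_add_of_le hm
      exact ⟨Q, pow_two_smul_eq_of_pow_succ_smul_eq htors hQ⟩
    · obtain ⟨j, rfl⟩ := Nat.exists_eq_add_of_le hm
      refine ⟨2 ^ (j + 1) • R, ?_⟩
      rw [smul_smul]
      congr 1
      ring
  · rintro ⟨Q, rfl⟩
    exact ⟨Q, by rw [pow_succ', mul_smul]⟩

theorem nuval_two_smul
    (htors : ∀ x : G, (∃ k : ℕ, 2 ^ k • x = 0) → 2 ^ n₀ • x = 0)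
    {P : G} (hP : ∃ Q : G, 2 ^ (n₀ + 1) • Q = P) :
    nuval (2 • P) = nuval P + 1 := by
  apply le_antisymm
  · refine sSup_le ?_
    rintro _ ⟨n, rfl, hn⟩
    obtain _ | m := n
    · simp
    · rw [Nat.cast_succ]
      gcongr
      exact le_sSup ⟨m, rfl, (exists_pow_succ_smul_eq_two_smul_iff htors hP m).1 hn⟩
  · have hne : {x : ℕ∞ | ∃ n : ℕ, x = (n : ℕ∞) ∧ ∃ Q : G, 2 ^ n • Q = P}.Nonempty :=
      ⟨_, n₀ + 1, rfl, hP⟩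
    rw [nuval, nuval, ENat.sSup_add hne]
    refine iSup₂_le ?_
    rintro _ ⟨m, rfl, hm⟩
    exact le_sSup ⟨m + 1, by push_cast; rfl,
      (exists_pow_succ_smul_eq_two_smul_iff htors hP m).2 hm⟩

theorem qmap_two_smul
    (htors : ∀ x : G, (∃ k : ℕ, 2 ^ k • x = 0) → 2 ^ n₀ • x = 0)
    {P : G} (hP : ∃ Q : G, 2 ^ (n₀ + 1) • Q = P) :
    qmap (2 • P) = qmap P := by
  apply Set.Subset.antisymm
  · obtain ⟨R, rfl⟩ := hP
    rintro _ ⟨Q, ⟨m, hm⟩, rfl⟩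
    obtain hlt | hle := lt_or_ge n₀ m
    · obtain ⟨j, rfl⟩ := Nat.exists_eq_add_of_lt hlt
      exact ⟨Q, ⟨n₀ + j, pow_two_smul_eq_of_pow_succ_smul_eq htors hm⟩, rfl⟩
    · obtain ⟨j, rfl⟩ := Nat.exists_eq_add_of_le hle
      -- `Q` differs from a torsion element by an even one; shift that torsion element by `2R`.
      have hT : 2 ^ (m + j) • (Q - 2 ^ (j + 2) • R) = 0 := by
        refine htors _ ⟨m, ?_⟩
        rw [smul_sub, hm, sub_eq_zero, smul_smul, smul_smul]
        congr 1
        ring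
      refine ⟨Q - 2 ^ (j + 2) • R + 2 • R, ⟨m + j, ?_⟩, ?_⟩
      · rw [smul_add, hT, zero_add, smul_smul, pow_succ]
      · refine QuotientAddGroup.eq.2 ⟨2 ^ (j + 1) • R - R, ?_⟩
        rw [smul_sub, smul_smul, ← pow_succ']
        abel
  · rintro _ ⟨Q, ⟨n, rfl⟩, rfl⟩
    exact ⟨Q, ⟨n + 1, by rw [pow_succ', mul_smul]⟩, rfl⟩

end

/-- Lemma 3.3 (2): if every element of `G` of 2-power order is killed by `2^{n₀}` and
`P ∈ 2^{n₀+1}·G` (i.e. `ν(P) > n₀`), then `ν(2P) = ν(P) + 1` and `q(2P) = q(P)`. -/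
theorem stmt14 (G : Type*) [AddCommGroup G] (n₀ : ℕ)
    (htors : ∀ x : G, (∃ k : ℕ, 2 ^ k • x = 0) → 2 ^ n₀ • x = 0)
    (P : G) (hP : ∃ Q : G, 2 ^ (n₀ + 1) • Q = P) :
    nuval ((2 : ℕ) • P) = nuval P + 1 ∧ qmap ((2 : ℕ) • P) = qmap P := by
  exact ⟨nuval_two_smul htors hP, qmap_two_smul htors hP⟩
end
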